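/- Let P and P' be lattice polytopes admitting regular unimodular triangulations T and T'. Then the product P × P' admits a regular unimodular triangulation whose set of minimal non-faces consists of lifts of minimal non-faces of T and of T' together with non-faces of cardinality two. In particular, if P and P' admit quadratic triangulations, so does P × P'. -/

import Mathlib

/-- `x` is a point of the standard lattice `ℤ^d ⊆ ℝ^d`. -/
def Zd {d : ℕ} (x : Fin d → ℝ) : Prop := ∀ i, ∃ z : ℤ, x i = (z : ℝ)

/-- `x` lies in the affine lattice generated (over `ℤ`) by the finite point set `F`. -/
def InAffLat {E : Type*} [AddCommGroup E] [Module ℝ E] (F : Finset E) (x : E) : Prop :=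
  ∃ c : E → ℤ, (∀ a, a ∉ F → c a = 0) ∧ (∑ a ∈ F, c a) = 1 ∧ (∑ a ∈ F, (c a : ℝ) • a) = x

/-- `F` is the vertex set of a unimodular simplex with respect to the lattice predicate `L`:
its vertices are affinely independent lattice points which affinely generate every lattice
point of their affine span. -/
def UnimodularFinset {E : Type*} [AddCommGroup E] [Module ℝ E] (L : E → Prop)
    (F : Finset E) : Prop :=
  (∀ a ∈ F, L a) ∧ AffineIndependent ℝ (fun p : F => (p : E)) ∧
    ∀ x, L x → x ∈ affineSpan ℝ (F : Set E) → InAffLat F x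

/-- A (geometric) triangulation of the set `P`, recorded by the vertex sets of its faces:
faces are affinely independent, the collection is closed under taking subsets, convex hulls
of faces intersect in the convex hull of the common vertices, and the faces cover `P`. -/
def IsTriangulation {E : Type*} [AddCommGroup E] [Module ℝ E]
    (P : Set E) (T : Finset (Finset E)) : Prop :=
  (∀ F ∈ T, AffineIndependent ℝ (fun p : F => (p : E))) ∧
  (∀ F ∈ T, ∀ G, G ⊆ F → G ∈ T) ∧
  (∀ F ∈ T, ∀ G ∈ T,
    convexHull ℝ (F : Set E) ∩ convexHull ℝ (G : Set E) =
      convexHull ℝ ((F : Set E) ∩ (G : Set E))) ∧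
  (⋃ F ∈ T, convexHull ℝ (F : Set E)) = P

/-- `F` is a maximal cell of the triangulation `T`. -/
def MaxCell {E : Type*} (T : Finset (Finset E)) (F : Finset E) : Prop :=
  F ∈ T ∧ ∀ G ∈ T, F ⊆ G → G = F

/-- A triangulation is unimodular when all of its maximal cells are unimodular simplices. -/
def IsUnimodular {E : Type*} [AddCommGroup E] [Module ℝ E] (L : E → Prop)
    (T : Finset (Finset E)) : Prop :=
  ∀ F, MaxCell T F → UnimodularFinset L F

/-- A triangulation is regular when its maximal cells are the domains of linearity of a
piecewise linear convex function on `P`. -/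
def IsRegularTri {E : Type*} [AddCommGroup E] [Module ℝ E]
    (P : Set E) (T : Finset (Finset E)) : Prop :=
  ∃ f : E → ℝ, ConvexOn ℝ P f ∧
    (∀ F, MaxCell T F → ∃ g : E →ᵃ[ℝ] ℝ, Set.EqOn f (⇑g) (convexHull ℝ (F : Set E))) ∧
    (∀ F G, MaxCell T F → MaxCell T G → F ≠ G →
      ¬ ∃ g : E →ᵃ[ℝ] ℝ,
        Set.EqOn f (⇑g) (convexHull ℝ (F : Set E) ∪ convexHull ℝ (G : Set E)))

/-- `N` is a minimal non-face of the triangulation `T`: a set of vertices of `T` which is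
not a face, all of whose proper subsets are faces. -/
def MinNonFace {E : Type*} (T : Finset (Finset E)) (N : Finset E) : Prop :=
  (∀ x ∈ N, ({x} : Finset E) ∈ T) ∧ N ∉ T ∧ ∀ M, M ⊂ N → M ∈ T

/-- A triangulation is flag when all of its minimal non-faces have exactly two elements. -/
def IsFlag {E : Type*} (T : Finset (Finset E)) : Prop :=
  ∀ N, MinNonFace T N → N.card = 2

/-- A triangulation of `P` is full when every lattice point of `P` is one of its vertices. -/
def IsFull {E : Type*} (L : E → Prop) (P : Set E) (T : Finset (Finset E)) : Prop :=
  ∀ x ∈ P, L x → ({x} : Finset E) ∈ T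

/-- `P` is a lattice polytope with respect to the lattice predicate `L`. -/
def IsLatticePolytope {E : Type*} [AddCommGroup E] [Module ℝ E] (L : E → Prop)
    (P : Set E) : Prop :=
  ∃ V : Finset E, V.Nonempty ∧ (∀ v ∈ V, L v) ∧ P = convexHull ℝ (V : Set E)

open Finset Filter Topology

section Barycentric

variable {E : Type*} [AddCommGroup E] [Module ℝ E]

/-- `w` is a system of convex weights supported on `F` with barycenter `x`. -/
def IsBary (F : Finset E) (w : E → ℝ) (x : E) : Prop :=
  (∀ v, 0 ≤ w v) ∧ (∀ v, v ∉ F → w v = 0) ∧ ∑ v ∈ F, w v = 1 ∧ ∑ v ∈ F, w v • v = x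

theorem IsBary.sum_eq {F : Finset E} {w : E → ℝ} {x : E} (h : IsBary F w x) {V : Finset E}
    (hV : F ⊆ V) (u : E → ℝ) : ∑ v ∈ V, w v * u v = ∑ v ∈ F, w v * u v := by
  refine (sum_subset hV fun v _ hv => ?_).symm
  rw [h.2.1 v hv, zero_mul]

theorem IsBary.mono {F G : Finset E} {w : E → ℝ} {x : E} (h : IsBary F w x) (hFG : F ⊆ G) :
    IsBary G w x := by
  refine ⟨h.1, fun v hv => h.2.1 v fun hF => hv (hFG hF), ?_, ?_⟩
  · rw [← h.2.2.1]
    exact (sum_subset hFG fun v _ hv => h.2.1 v hv).symm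
  · rw [← h.2.2.2]
    exact (sum_subset hFG fun v _ hv => by rw [h.2.1 v hv, zero_smul]).symm

theorem mem_convexHull_iff_exists_isBary {F : Finset E} {x : E} :
    x ∈ convexHull ℝ (F : Set E) ↔ ∃ w, IsBary F w x := by
  classical
  rw [Finset.mem_convexHull']
  constructor
  · rintro ⟨w, h0, h1, hx⟩
    refine ⟨fun v => if v ∈ F then w v else 0, fun v => ?_, fun v hv => if_neg hv, ?_, ?_⟩
    · dsimp only
      split_ifs with hv
      exacts [h0 v hv, le_rfl]
    · rw [← h1]
      exact sum_congr rfl fun v hv => if_pos hv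
    · rw [← hx]
      exact sum_congr rfl fun v hv => by simp only [if_pos hv]
  · rintro ⟨w, h0, -, h1, hx⟩
    exact ⟨w, fun v _ => h0 v, h1, hx⟩

theorem IsBary.single {F : Finset E} {v : E} (hv : v ∈ F) [DecidableEq E] :
    IsBary F (fun u => if u = v then 1 else 0) v := by
  refine ⟨fun u => ?_, fun u hu => if_neg fun h : u = v => hu (h ▸ hv), ?_, ?_⟩
  · dsimp only
    split_ifs <;> norm_num
  · simp [hv]
  · simp [ite_smul, hv]

theorem affineIndependent_finset_iff {F : Finset E} :
    AffineIndependent ℝ (fun p : F => (p : E)) ↔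
      ∀ w : E → ℝ, ∑ v ∈ F, w v = 0 → ∑ v ∈ F, w v • v = 0 → ∀ v ∈ F, w v = 0 := by
  classical
  rw [affineIndependent_iff_of_fintype]
  constructor
  · intro h w h0 h1 v hv
    refine h (fun p => w p) ?_ ?_ ⟨v, hv⟩
    · rw [← h0, ← sum_coe_sort F]
    · rw [weightedVSub_eq_linear_combination _ (by rw [← h0, ← sum_coe_sort F]), ← h1, ← sum_coe_sort F]
  · intro h w h0 h1 ⟨v, hv⟩
    rw [weightedVSub_eq_linear_combination _ h0] at h1
    have key := h (fun v => if hv : v ∈ F then w ⟨v, hv⟩ else 0) ?_ ?_ v hv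
    · simpa [hv] using key
    · rw [← sum_coe_sort F]
      simpa using h0
    · rw [← sum_coe_sort F]
      simpa using h1

theorem AffineIndependent.eq_weights {F : Finset E}
    (hF : AffineIndependent ℝ (fun p : F => (p : E))) {w u : E → ℝ}
    (h0 : ∑ v ∈ F, w v = ∑ v ∈ F, u v) (h1 : ∑ v ∈ F, w v • v = ∑ v ∈ F, u v • v) :
    ∀ v ∈ F, w v = u v := by
  intro v hv
  refine sub_eq_zero.mp (affineIndependent_finset_iff.mp hF (fun v => w v - u v) ?_ ?_ v hv)
  · rw [sum_sub_distrib, h0, sub_self]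
  · simp only [sub_smul, sum_sub_distrib, h1, sub_self]

theorem IsBary.unique_of_affineIndependent {F : Finset E}
    (hF : AffineIndependent ℝ (fun p : F => (p : E))) {w u : E → ℝ} {x : E}
    (hw : IsBary F w x) (hu : IsBary F u x) : w = u := by
  funext v
  by_cases hv : v ∈ F
  · exact hF.eq_weights (hw.2.2.1.trans hu.2.2.1.symm) (hw.2.2.2.trans hu.2.2.2.symm) v hv
  · rw [hw.2.1 v hv, hu.2.1 v hv]

/-- A point of the affine span of a finite set is an affine combination of it. -/
theorem exists_weights_of_mem_affineSpan {F : Finset E} {x : E}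
    (hx : x ∈ affineSpan ℝ (F : Set E)) :
    ∃ w : E → ℝ, ∑ v ∈ F, w v = 1 ∧ ∑ v ∈ F, w v • v = x := by
  classical
  have hx' : x ∈ affineSpan ℝ (Set.range (fun p : F => (p : E))) := by simpa using hx
  obtain ⟨w, h1, h2⟩ := eq_affineCombination_of_mem_affineSpan_of_fintype hx'
  rw [affineCombination_eq_linear_combination _ _ _ h1] at h2
  refine ⟨fun v => if hv : v ∈ F then w ⟨v, hv⟩ else 0, ?_, ?_⟩
  · rw [← sum_coe_sort F]
    simpa using h1
  · rw [← sum_coe_sort F]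
    simpa using h2.symm

/-- Prescribed values on an affinely independent set extend to an affine map. -/
theorem AffineIndependent.exists_affineMap {F : Finset E}
    (hF : AffineIndependent ℝ (fun p : F => (p : E))) (u : E → ℝ) :
    ∃ g : E →ᵃ[ℝ] ℝ, ∀ v ∈ F, g v = u v := by
  classical
  have hF' : AffineIndependent ℝ (fun p : (F : Set E) => (p : E)) := hF
  obtain ⟨t, hFt, ht, htop⟩ := exists_subset_affineIndependent_affineSpan_eq_top hF'
  let b : AffineBasis t ℝ E := ⟨fun p => p, ht, by simpa using htop⟩
  refine ⟨∑ p : F, u p • b.coord ⟨p, hFt p.2⟩, fun v hv => ?_⟩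
  have hb : ∀ p : F, b.coord ⟨p, hFt p.2⟩ v = if p = ⟨v, hv⟩ then 1 else 0 := by
    intro p
    refine (b.coord_apply ⟨p, hFt p.2⟩ ⟨v, hFt hv⟩).trans ?_
    simp [Subtype.ext_iff]
  have hs : ∀ s : Finset F, (∑ p ∈ s, u p • b.coord ⟨p, hFt p.2⟩) v =
      ∑ p ∈ s, u p * b.coord ⟨p, hFt p.2⟩ v := by
    intro s
    induction s using Finset.induction_on with
    | empty => simp
    | insert a s ha ih => simp [sum_insert ha, ← ih]
  simp [hs, hb]

theorem AffineMap.map_isBary (g : E →ᵃ[ℝ] ℝ) {F : Finset E} {w : E → ℝ} {x : E}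
    (h : IsBary F w x) : g x = ∑ v ∈ F, w v * g v := by
  have := F.map_affineCombination (fun v => v) w h.2.2.1 g
  rw [affineCombination_eq_linear_combination _ _ _ h.2.2.1,
    affineCombination_eq_linear_combination _ _ _ h.2.2.1, h.2.2.2] at this
  simpa using this

end Barycentric

section Triangulation

variable {E : Type*} [AddCommGroup E] [Module ℝ E] {P : Set E} {T : Finset (Finset E)}

theorem IsTriangulation.bary_unique (hT : IsTriangulation P T) {F G : Finset E} (hF : F ∈ T)
    (hG : G ∈ T) {w u : E → ℝ} {x : E} (hw : IsBary F w x) (hu : IsBary G u x) : w = u := by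
  classical
  have hx : x ∈ convexHull ℝ ((F ∩ G : Finset E) : Set E) := by
    rw [coe_inter, ← hT.2.2.1 F hF G hG]
    exact ⟨mem_convexHull_iff_exists_isBary.mpr ⟨w, hw⟩,
      mem_convexHull_iff_exists_isBary.mpr ⟨u, hu⟩⟩
  obtain ⟨z, hz⟩ := mem_convexHull_iff_exists_isBary.mp hx
  rw [hw.unique_of_affineIndependent (hT.1 F hF) (hz.mono inter_subset_left),
    hu.unique_of_affineIndependent (hT.1 G hG) (hz.mono inter_subset_right)]

theorem IsTriangulation.mem_iff (hT : IsTriangulation P T) {x : E} :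
    x ∈ P ↔ ∃ F ∈ T, ∃ w, IsBary F w x := by
  rw [← hT.2.2.2]
  simp [mem_convexHull_iff_exists_isBary]

theorem isTriangulation_of_bary_unique
    (hind : ∀ F ∈ T, AffineIndependent ℝ (fun p : F => (p : E)))
    (hdown : ∀ F ∈ T, ∀ G, G ⊆ F → G ∈ T)
    (huniq : ∀ F ∈ T, ∀ G ∈ T, ∀ w u x, IsBary F w x → IsBary G u x → w = u)
    (hmem : ∀ x, x ∈ P ↔ ∃ F ∈ T, ∃ w, IsBary F w x) : IsTriangulation P T := by
  classical
  refine ⟨hind, hdown, fun F hF G hG => ?_, ?_⟩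
  · apply Set.Subset.antisymm
    · rintro x ⟨hx, hx'⟩
      obtain ⟨w, hw⟩ := mem_convexHull_iff_exists_isBary.mp hx
      obtain ⟨u, hu⟩ := mem_convexHull_iff_exists_isBary.mp hx'
      have hwu := huniq F hF G hG w u x hw hu
      subst hwu
      rw [← coe_inter, mem_convexHull_iff_exists_isBary]
      have hz : ∀ v, v ∉ F ∩ G → w v = 0 := fun v hv => by
        by_cases h : v ∈ F
        · exact hu.2.1 v fun h' => hv (mem_inter.mpr ⟨h, h'⟩)
        · exact hw.2.1 v h
      refine ⟨w, hw.1, hz, ?_, ?_⟩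
      · rw [← hw.2.2.1]
        exact sum_subset inter_subset_left fun v _ hv => hz v hv
      · rw [← hw.2.2.2]
        exact sum_subset inter_subset_left fun v _ hv => by rw [hz v hv, zero_smul]
    · exact Set.subset_inter (convexHull_mono Set.inter_subset_left)
        (convexHull_mono Set.inter_subset_right)
  · ext x
    rw [hmem]
    simp [mem_convexHull_iff_exists_isBary]

theorem exists_maxCell {E : Type*} {T : Finset (Finset E)} {F : Finset E} (hF : F ∈ T) :
    ∃ G, MaxCell T G ∧ F ⊆ G := by
  obtain ⟨G, hFG, hG⟩ := T.exists_le_maximal hF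
  exact ⟨G, ⟨hG.1, fun H hH hGH => (hG.2 hH hGH).antisymm hGH⟩, hFG⟩

theorem IsTriangulation.exists_maxCell_bary (hT : IsTriangulation P T) {x : E} (hx : x ∈ P) :
    ∃ G, MaxCell T G ∧ ∃ w, IsBary G w x := by
  obtain ⟨F, hF, w, hw⟩ := hT.mem_iff.mp hx
  obtain ⟨G, hG, hFG⟩ := exists_maxCell hF
  exact ⟨G, hG, w, hw.mono hFG⟩

theorem IsTriangulation.mem_of_mem_face (hT : IsTriangulation P T) {F : Finset E} (hF : F ∈ T)
    {v : E} (hv : v ∈ F) : v ∈ P := by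
  classical
  exact hT.mem_iff.mpr ⟨F, hF, _, IsBary.single hv⟩

/-- A vertex lying in the convex hull of a face belongs to that face. -/
theorem IsTriangulation.mem_face_of_mem_convexHull (hT : IsTriangulation P T) {F G : Finset E}
    (hF : F ∈ T) (hG : G ∈ T) {v : E} (hv : v ∈ F) (h : v ∈ convexHull ℝ (G : Set E)) :
    v ∈ G := by
  classical
  obtain ⟨w, hw⟩ := mem_convexHull_iff_exists_isBary.mp h
  by_contra hvG
  have := hw.2.1 v hvG
  rw [← hT.bary_unique hF hG (IsBary.single hv) hw] at this
  simp at this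

end Triangulation

/-- `k` is affine on every face of `T`. -/
def AffineOnFaces {E : Type*} [AddCommGroup E] [Module ℝ E] (T : Finset (Finset E))
    (k : E → ℝ) : Prop :=
  ∀ F ∈ T, ∀ w x, IsBary F w x → k x = ∑ v ∈ F, w v * k v

/-- Any values on the vertices extend to a function which is affine on the faces. -/
theorem IsTriangulation.exists_affineOnFaces {E : Type*} [AddCommGroup E] [Module ℝ E] {P : Set E}
    {T : Finset (Finset E)} (hT : IsTriangulation P T) (u : E → ℝ) :
    ∃ k, AffineOnFaces T k ∧ ∀ v, {v} ∈ T → k v = u v := by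
  classical
  have hex : ∀ x, ∃ r : ℝ, ∀ F ∈ T, ∀ w, IsBary F w x → r = ∑ v ∈ F, w v * u v := by
    intro x
    by_cases h : ∃ F ∈ T, ∃ w, IsBary F w x
    · obtain ⟨F, hF, w, hw⟩ := h
      refine ⟨∑ v ∈ F, w v * u v, fun G hG z hz => ?_⟩
      rw [← hw.sum_eq subset_union_left, ← hz.sum_eq subset_union_right,
        hT.bary_unique hF hG hw hz]
    · exact ⟨0, fun F hF w hw => absurd ⟨F, hF, w, hw⟩ h⟩
  choose k hk using hex
  have hku : ∀ v, {v} ∈ T → k v = u v := fun v hv => by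
    rw [hk v _ hv _ (IsBary.single (mem_singleton_self v))]
    simp
  refine ⟨k, fun F hF w x hw => ?_, hku⟩
  rw [hk x F hF w hw]
  refine sum_congr rfl fun v hv => ?_
  rw [hku v (hT.2.1 F hF _ (singleton_subset_iff.mpr hv))]

section Regularity

theorem eventually_combo_ne_zero {a b : ℝ} (h : a ≠ 0 ∨ b ≠ 0) :
    ∀ᶠ t in 𝓝[>] (0 : ℝ), (1 - t) * a + t * b ≠ 0 := by
  by_cases ha : a = 0
  · filter_upwards [self_mem_nhdsWithin] with t ht
    have hb : b ≠ 0 := h.resolve_left fun h => h ha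
    have ht' : t ≠ 0 := ne_of_gt ht
    simp [ha, hb, ht']
  · have hc : ContinuousAt (fun t : ℝ => (1 - t) * a + t * b) 0 := by fun_prop
    exact (hc.eventually_ne (by simpa using ha)).filter_mono nhdsWithin_le_nhds

theorem eventually_mem_Ioo_zero_one : ∀ᶠ t in 𝓝[>] (0 : ℝ), 0 < t ∧ t < 1 :=
  Ioo_mem_nhdsGT one_pos

theorem eventually_combo {E : Type*} [NormedAddCommGroup E] [NormedSpace ℝ E] {q : E → Prop}
    {x : E} (h : ∀ᶠ z in 𝓝 x, q z) (y : E) :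
    ∀ᶠ t in 𝓝[>] (0 : ℝ), q ((1 - t) • x + t • y) := by
  have hc : Tendsto (fun t : ℝ => (1 - t) • x + t • y) (𝓝[>] 0) (𝓝 x) := by
    have : ContinuousAt (fun t : ℝ => (1 - t) • x + t • y) 0 := by fun_prop
    have h0 := this.tendsto
    simp only [sub_zero, one_smul, zero_smul, add_zero] at h0
    exact h0.mono_left nhdsWithin_le_nhds
  exact hc.eventually h

theorem AffineMap.map_combo {E : Type*} [AddCommGroup E] [Module ℝ E] (g : E →ᵃ[ℝ] ℝ) (x y : E)
    (t : ℝ) : g ((1 - t) • x + t • y) = (1 - t) * g x + t * g y :=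
  Convex.combo_affine_apply (by ring)

/-- Finitely many affine functions, none of which vanishes identically on a convex set, are
simultaneously nonzero at some point of it. -/
theorem Convex.exists_forall_affineMap_ne_zero {E ι : Type*} [AddCommGroup E] [Module ℝ E]
    {P : Set E} (hP : Convex ℝ P) (hne : P.Nonempty) (S : Finset ι) (l : ι → E →ᵃ[ℝ] ℝ)
    (h : ∀ i ∈ S, ∃ p ∈ P, l i p ≠ 0) : ∃ p ∈ P, ∀ i ∈ S, l i p ≠ 0 := by
  classical
  induction S using Finset.induction_on with
  | empty =>
    obtain ⟨p, hp⟩ := hne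
    exact ⟨p, hp, by simp⟩
  | insert a S ha ih =>
    obtain ⟨p, hp, hpS⟩ := ih fun i hi => h i (mem_insert_of_mem hi)
    obtain ⟨q, hq, hqa⟩ := h a (mem_insert_self a S)
    have hev : ∀ᶠ t in 𝓝[>] (0 : ℝ), ∀ i ∈ insert a S, (1 - t) * l i p + t * l i q ≠ 0 := by
      rw [eventually_all_finset]
      intro i hi
      apply eventually_combo_ne_zero
      rcases mem_insert.mp hi with rfl | hi
      exacts [Or.inr hqa, Or.inl (hpS i hi)]
    obtain ⟨t, ht, h0, h1⟩ := (hev.and eventually_mem_Ioo_zero_one).exists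
    refine ⟨(1 - t) • p + t • q, hP hp hq (by linarith) h0.le (by ring), fun i hi => ?_⟩
    rw [AffineMap.map_combo]
    exact ht i hi

variable {E : Type*} [NormedAddCommGroup E] [NormedSpace ℝ E] {P : Set E}
  {T : Finset (Finset E)}

theorem MaxCell.nonempty (hT : IsTriangulation P T) {G : Finset E} (hG : MaxCell T G)
    (hP : P.Nonempty) : G.Nonempty := by
  obtain ⟨y, hy⟩ := hP
  obtain ⟨F, hF, w, hw⟩ := hT.mem_iff.mp hy
  by_contra hne
  rw [not_nonempty_iff_eq_empty] at hne
  subst hne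
  have := hG.2 F hF (empty_subset F)
  subst this
  simpa using hw.2.2.1

/-- A maximal cell is a relative neighborhood of some point of the triangulated set. -/
theorem MaxCell.exists_relative_interior (hT : IsTriangulation P T) {G : Finset E}
    (hG : MaxCell T G) (hP : P.Nonempty) :
    ∃ x ∈ P, x ∈ convexHull ℝ (G : Set E) ∧
      ∀ᶠ z in 𝓝 x, z ∈ P → z ∈ convexHull ℝ (G : Set E) := by
  classical
  have hne := hG.nonempty hT hP
  have hc : (0 : ℝ) < #G := by exact_mod_cast hne.card_pos
  let w : E → ℝ := fun v => if v ∈ G then (#G : ℝ)⁻¹ else 0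
  have hw : IsBary G w (∑ v ∈ G, w v • v) := by
    refine ⟨fun v => ?_, fun v hv => if_neg hv, ?_, rfl⟩
    · dsimp only [w]
      split_ifs <;> positivity
    · rw [sum_congr rfl fun v hv => if_pos hv, sum_const, nsmul_eq_mul, mul_inv_cancel₀ hc.ne']
  set x := ∑ v ∈ G, w v • v
  refine ⟨x, hT.mem_iff.mpr ⟨G, hG.1, w, hw⟩, mem_convexHull_iff_exists_isBary.mpr ⟨w, hw⟩, ?_⟩
  have hcl : IsClosed (⋃ F ∈ T.erase G, convexHull ℝ (F : Set E)) :=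
    (T.erase G).finite_toSet.isClosed_biUnion fun F _ => F.finite_toSet.isClosed_convexHull ℝ
  have hx : x ∉ ⋃ F ∈ T.erase G, convexHull ℝ (F : Set E) := by
    simp only [Set.mem_iUnion, not_exists]
    intro F hF hxF
    obtain ⟨hne, hFT⟩ := mem_erase.mp hF
    obtain ⟨u, hu⟩ := mem_convexHull_iff_exists_isBary.mp hxF
    have hwu := hT.bary_unique hG.1 hFT hw hu
    refine hne (hG.2 F hFT fun v hv => ?_)
    by_contra hvF
    have h0 := hu.2.1 v hvF
    rw [← hwu] at h0
    simp only [w, if_pos hv, inv_eq_zero] at h0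
    exact hc.ne' h0
  filter_upwards [hcl.isOpen_compl.mem_nhds hx] with z hz hzP
  obtain ⟨F, hF, u, hu⟩ := hT.mem_iff.mp hzP
  have hzF := mem_convexHull_iff_exists_isBary.mpr ⟨u, hu⟩
  by_cases h : F = G
  · exact h ▸ hzF
  · exact absurd (Set.mem_biUnion (mem_coe.mpr (mem_erase.mpr ⟨h, hF⟩)) hzF) hz

/-- A convex function lies above its affine pieces on the maximal cells. -/
theorem MaxCell.le_of_convexOn (hT : IsTriangulation P T) {G : Finset E} (hG : MaxCell T G)
    {f : E → ℝ} (hf : ConvexOn ℝ P f) {g : E →ᵃ[ℝ] ℝ}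
    (hg : Set.EqOn f g (convexHull ℝ (G : Set E))) {y : E} (hy : y ∈ P) : g y ≤ f y := by
  obtain ⟨x, hxP, hxG, hx⟩ := hG.exists_relative_interior hT ⟨y, hy⟩
  obtain ⟨t, ht, h0, h1⟩ := ((eventually_combo hx y).and eventually_mem_Ioo_zero_one).exists
  have h2 := hf.2 hxP hy (sub_nonneg.mpr h1.le) h0.le (by ring)
  rw [hg (ht (hf.1 hxP hy (by linarith) h0.le (by ring))), AffineMap.map_combo, hg hxG] at h2
  simp only [smul_eq_mul] at h2
  nlinarith

/-- The affine pieces `g` of a convex function `f` certify that `T` is regular. -/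
def IsRegularWitness (P : Set E) (T : Finset (Finset E)) (f : E → ℝ)
    (g : Finset E → E →ᵃ[ℝ] ℝ) : Prop :=
  ConvexOn ℝ P f ∧
    (∀ F, MaxCell T F → Set.EqOn f (g F) (convexHull ℝ (F : Set E))) ∧
    ∀ F G, MaxCell T F → MaxCell T G → F ≠ G → ∃ v ∈ F, f v ≠ g G v

theorem IsRegularTri.exists_witness (h : IsRegularTri P T) :
    ∃ f g, IsRegularWitness P T f g := by
  obtain ⟨f, hf, hlin, hsep⟩ := h
  choose! g hg using hlin
  refine ⟨f, g, hf, hg, fun F G hF hG hne => ?_⟩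
  by_contra! hall
  refine hsep F G hF hG hne ⟨g G, ?_⟩
  rintro x (hx | hx)
  · obtain ⟨w, hw⟩ := mem_convexHull_iff_exists_isBary.mp hx
    rw [hg F hF hx, (g F).map_isBary hw, (g G).map_isBary hw]
    refine sum_congr rfl fun v hv => ?_
    rw [← hall v hv, hg F hF (subset_convexHull ℝ _ hv)]
  · exact hg G hG hx

/-- The domain of linearity of a regularity witness is exactly the maximal cell. -/
theorem IsRegularWitness.mem_convexHull (hT : IsTriangulation P T) {f : E → ℝ}
    {g : Finset E → E →ᵃ[ℝ] ℝ} (h : IsRegularWitness P T f g) {G : Finset E}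
    (hG : MaxCell T G) {y : E} (hy : y ∈ P) (hfy : f y = g G y) :
    y ∈ convexHull ℝ (G : Set E) := by
  classical
  by_contra hyG
  obtain ⟨hf, hg, hsep⟩ := h
  obtain ⟨x, hxP, hxG, hx⟩ := hG.exists_relative_interior hT ⟨y, hy⟩
  have hcl : IsClosed (convexHull ℝ (G : Set E)) := G.finite_toSet.isClosed_convexHull ℝ
  obtain ⟨t, ht, h0, h1⟩ := ((eventually_combo (hcl.isOpen_compl.mem_nhds hyG) x).and
    eventually_mem_Ioo_zero_one).exists
  let l : Finset E → E →ᵃ[ℝ] ℝ := fun F => (g F - g G).comp (AffineMap.homothety y t)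
  have hl : ∀ F p, l F p = g F ((1 - t) • y + t • p) - g G ((1 - t) • y + t • p) := by
    intro F p
    simp [l, AffineMap.homothety_eq_lineMap, AffineMap.lineMap_apply_module]
  obtain ⟨p, hpP, hp⟩ := hf.1.exists_forall_affineMap_ne_zero ⟨y, hy⟩
    (T.filter fun F => MaxCell T F ∧ F ≠ G) l fun F hF => by
      obtain ⟨-, hF, hFG⟩ := mem_filter.mp hF
      obtain ⟨v, hv, hvne⟩ := hsep F G hF hG hFG
      have hvP := hT.mem_of_mem_face hF.1 hv
      have hFv := hg F hF (subset_convexHull ℝ _ hv)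
      have hGv := lt_of_le_of_ne (hG.le_of_convexOn hT hf (hg G hG) hvP) hvne.symm
      have hFx := hF.le_of_convexOn hT hf (hg F hF) hxP
      have hGx := hg G hG hxG
      by_contra! hall
      have h2 := hall v hvP
      have h3 := hall x hxP
      rw [hl, AffineMap.map_combo, AffineMap.map_combo] at h2 h3
      nlinarith
  have hz : ∀ᶠ q in 𝓝 x, (1 - t) • y + t • q ∈ (convexHull ℝ (G : Set E))ᶜ := by
    have hc : ContinuousAt (fun q : E => (1 - t) • y + t • q) x := by fun_prop
    exact hc.eventually_mem (hcl.isOpen_compl.mem_nhds ht)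
  have hS : ∀ᶠ s in 𝓝[>] (0 : ℝ), ∀ F ∈ T.filter fun F => MaxCell T F ∧ F ≠ G,
      (1 - s) * l F x + s * l F p ≠ 0 := by
    rw [eventually_all_finset]
    exact fun F hF => eventually_combo_ne_zero (Or.inr (hp F hF))
  obtain ⟨s, ⟨⟨hs1, hs2⟩, hs3⟩, hs0, hs1'⟩ :=
    ((((eventually_combo hx p).and (eventually_combo hz p)).and hS).and
      eventually_mem_Ioo_zero_one).exists
  set q := (1 - s) • x + s • p with hq
  have hqP : q ∈ P := hf.1 hxP hpP (by linarith) hs0.le (by ring)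
  have hzP : (1 - t) • y + t • q ∈ P := hf.1 hy hqP (by linarith) h0.le (by ring)
  obtain ⟨F, hF, w, hw⟩ := hT.exists_maxCell_bary hzP
  have hzF := mem_convexHull_iff_exists_isBary.mpr ⟨w, hw⟩
  have hFG : F ≠ G := fun h => hs2 (h ▸ hzF)
  apply hs3 F (mem_filter.mpr ⟨hF.1, hF, hFG⟩)
  rw [← AffineMap.map_combo, ← hq, hl, ← hg F hF hzF]
  have h2 := hf.2 hy hqP (sub_nonneg.mpr h1.le) h0.le (by ring)
  rw [smul_eq_mul, smul_eq_mul, hfy, hg G hG (hs1 hqP), ← AffineMap.map_combo] at h2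
  linarith [hG.le_of_convexOn hT hf (hg G hG) hzP]

/-- Points at which a regularity witness satisfies Jensen's equality span a face. -/
theorem IsRegularWitness.image_mem_of_jensen_eq (hT : IsTriangulation P T) {f : E → ℝ}
    {g : Finset E → E →ᵃ[ℝ] ℝ} (h : IsRegularWitness P T f g) {ι : Type*} [DecidableEq E]
    {s : Finset ι} {w : ι → ℝ} {p : ι → E} (hw : ∀ i ∈ s, 0 < w i) (hw1 : ∑ i ∈ s, w i = 1)
    (hp : ∀ i ∈ s, {p i} ∈ T) (hf : f (∑ i ∈ s, w i • p i) = ∑ i ∈ s, w i * f (p i)) :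
    s.image p ∈ T := by
  have hpP : ∀ i ∈ s, p i ∈ P := fun i hi => hT.mem_of_mem_face (hp i hi) (mem_singleton_self _)
  have hm : ∑ i ∈ s, w i • p i ∈ P :=
    h.1.1.sum_mem (fun i hi => (hw i hi).le) hw1 hpP
  obtain ⟨G, hG, u, hu⟩ := hT.exists_maxCell_bary hm
  have hle : ∀ i ∈ s, w i * g G (p i) ≤ w i * f (p i) := fun i hi =>
    mul_le_mul_of_nonneg_left (hG.le_of_convexOn hT h.1 (h.2.1 G hG) (hpP i hi)) (hw i hi).le
  have hg : g G (∑ i ∈ s, w i • p i) = ∑ i ∈ s, w i * g G (p i) := by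
    have := s.map_affineCombination p w hw1 (g G)
    rw [affineCombination_eq_linear_combination _ _ _ hw1,
      affineCombination_eq_linear_combination _ _ _ hw1] at this
    simpa using this
  rw [h.2.1 G hG (mem_convexHull_iff_exists_isBary.mpr ⟨u, hu⟩), hg,
    sum_eq_sum_iff_of_le hle] at hf
  refine hT.2.1 G hG.1 _ (image_subset_iff.mpr fun i hi => ?_)
  refine hT.mem_face_of_mem_convexHull (hp i hi) hG.1 (mem_singleton_self _) ?_
  exact h.mem_convexHull hT hG (hpP i hi) (mul_left_cancel₀ (hw i hi).ne' (hf i hi)).symm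

/-- A function which is affine on the cells becomes convex after adding a large multiple of a
regularity witness. -/
theorem IsRegularWitness.exists_convexOn_add (hT : IsTriangulation P T) {f : E → ℝ}
    {g : Finset E → E →ᵃ[ℝ] ℝ} (h : IsRegularWitness P T f g) {k : E → ℝ}
    (hk : AffineOnFaces T k) :
    ∃ K : ℝ, 0 ≤ K ∧ ConvexOn ℝ P fun x => K * f x + k x := by
  classical
  have hext : ∀ G : Finset E, ∃ u : E →ᵃ[ℝ] ℝ, G ∈ T → ∀ v ∈ G, u v = k v := fun G => by
    by_cases hG : G ∈ T
    · obtain ⟨u, hu⟩ := (hT.1 G hG).exists_affineMap k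
      exact ⟨u, fun _ => hu⟩
    · exact ⟨0, fun h => absurd h hG⟩
  choose u hu using hext
  have hK : ∀ᶠ K in atTop, ∀ G ∈ T, ∀ F ∈ T, ∀ v ∈ F, MaxCell T G →
      K * g G v + u G v ≤ K * f v + k v := by
    rw [eventually_all_finset]
    intro G hGT
    rw [eventually_all_finset]
    intro F hF
    rw [eventually_all_finset]
    intro v hv
    by_cases hG : MaxCell T G
    swap
    · exact Eventually.of_forall fun _ h => absurd h hG
    by_cases hvG : v ∈ G
    · refine Eventually.of_forall fun K _ => ?_
      rw [hu G hGT v hvG, h.2.1 G hG (subset_convexHull ℝ _ hvG)]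
    · have hvP := hT.mem_of_mem_face hF hv
      have hlt : g G v < f v :=
        lt_of_le_of_ne (hG.le_of_convexOn hT h.1 (h.2.1 G hG) hvP) fun heq =>
          hvG (hT.mem_face_of_mem_convexHull hF hGT hv (h.mem_convexHull hT hG hvP heq.symm))
      filter_upwards [eventually_ge_atTop ((u G v - k v) / (f v - g G v))] with K hK _
      rw [div_le_iff₀ (sub_pos.mpr hlt)] at hK
      linarith
  obtain ⟨K, hK, hK0⟩ := (hK.and (eventually_ge_atTop 0)).exists
  have hle : ∀ G, MaxCell T G → ∀ x ∈ P, K * g G x + u G x ≤ K * f x + k x := by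
    intro G hG x hx
    obtain ⟨F, hF, w, hw⟩ := hT.exists_maxCell_bary hx
    rw [hk F hF.1 w x hw, (g G).map_isBary hw, (u G).map_isBary hw,
      h.2.1 F hF (mem_convexHull_iff_exists_isBary.mpr ⟨w, hw⟩), (g F).map_isBary hw, mul_sum,
      mul_sum, ← sum_add_distrib, ← sum_add_distrib]
    refine sum_le_sum fun v hv => ?_
    have := mul_le_mul_of_nonneg_left (hK G hG.1 F hF.1 v hv hG) (hw.1 v)
    rw [h.2.1 F hF (subset_convexHull ℝ _ hv)] at this
    linarith
  refine ⟨K, hK0, h.1.1, fun x hx y hy a b ha hb hab => ?_⟩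
  obtain ⟨G, hG, w, hw⟩ := hT.exists_maxCell_bary (h.1.1 hx hy ha hb hab)
  have heq : K * f (a • x + b • y) + k (a • x + b • y) =
      K * g G (a • x + b • y) + u G (a • x + b • y) := by
    rw [hk G hG.1 w _ hw, (u G).map_isBary hw,
      h.2.1 G hG (mem_convexHull_iff_exists_isBary.mpr ⟨w, hw⟩)]
    congr 1
    exact sum_congr rfl fun v hv => by rw [hu G hG.1 v hv]
  simp only [smul_eq_mul]
  rw [heq, Convex.combo_affine_apply hab, Convex.combo_affine_apply hab]
  have h1 := mul_le_mul_of_nonneg_left (hle G hG x hx) ha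
  have h2 := mul_le_mul_of_nonneg_left (hle G hG y hy) hb
  simp only [smul_eq_mul]
  linarith

end Regularity

section PushForward

variable {X Y M : Type*} [DecidableEq Y]

/-- The push-forward of the weights `w` on `C` along `π`. -/
def pushWeight (π : X → Y) (C : Finset X) (w : X → ℝ) (y : Y) : ℝ :=
  ∑ q ∈ C with π q = y, w q

theorem sum_pushWeight_smul [AddCommGroup M] [Module ℝ M] {π : X → Y} {C : Finset X}
    {F : Finset Y} (h : C.image π ⊆ F) (w : X → ℝ) (u : Y → M) :
    ∑ y ∈ F, pushWeight π C w y • u y = ∑ q ∈ C, w q • u (π q) := by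
  rw [← sum_fiberwise_of_maps_to (fun q hq => h (mem_image_of_mem π hq))]
  refine sum_congr rfl fun y _ => ?_
  rw [pushWeight, sum_smul]
  exact sum_congr rfl fun q hq => by rw [(mem_filter.mp hq).2]

theorem sum_pushWeight {π : X → Y} {C : Finset X} {F : Finset Y} (h : C.image π ⊆ F)
    (w : X → ℝ) : ∑ y ∈ F, pushWeight π C w y = ∑ q ∈ C, w q := by
  simpa using sum_pushWeight_smul h w fun _ => (1 : ℝ)

theorem sum_filter_pushWeight {π : X → Y} {C : Finset X} {F : Finset Y} (h : C.image π ⊆ F)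
    (w : X → ℝ) (r : Y → Prop) [DecidablePred r] :
    ∑ y ∈ F with r y, pushWeight π C w y = ∑ q ∈ C with r (π q), w q := by
  simpa [sum_filter] using sum_pushWeight_smul h w fun y => if r y then (1 : ℝ) else 0

theorem pushWeight_eq_zero {π : X → Y} {C : Finset X} (w : X → ℝ) {y : Y}
    (hy : y ∉ C.image π) : pushWeight π C w y = 0 := by
  refine sum_eq_zero fun q hq => ?_
  obtain ⟨hqC, rfl⟩ := mem_filter.mp hq
  exact absurd (mem_image_of_mem π hqC) hy

theorem IsBary.push {E E' : Type*} [AddCommGroup E] [Module ℝ E] [AddCommGroup E'] [Module ℝ E']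
    [DecidableEq E'] {C : Finset E} {w : E → ℝ} {x : E} (h : IsBary C w x) (π : E →ₗ[ℝ] E') :
    IsBary (C.image π) (pushWeight π C w) (π x) := by
  refine ⟨fun y => sum_nonneg fun q _ => h.1 q, fun y hy => pushWeight_eq_zero w hy, ?_, ?_⟩
  · rw [sum_pushWeight subset_rfl, h.2.2.1]
  · rw [sum_pushWeight_smul subset_rfl, ← h.2.2.2, map_sum]
    simp

theorem IsBary.fst {E E' : Type*} [AddCommGroup E] [Module ℝ E] [AddCommGroup E'] [Module ℝ E']
    [DecidableEq E] {C : Finset (E × E')} {w : E × E' → ℝ} {x : E × E'} (h : IsBary C w x) :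
    IsBary (C.image Prod.fst) (pushWeight Prod.fst C w) x.1 :=
  h.push (LinearMap.fst ℝ E E')

theorem IsBary.snd {E E' : Type*} [AddCommGroup E] [Module ℝ E] [AddCommGroup E'] [Module ℝ E']
    [DecidableEq E'] {C : Finset (E × E')} {w : E × E' → ℝ} {x : E × E'} (h : IsBary C w x) :
    IsBary (C.image Prod.snd) (pushWeight Prod.snd C w) x.2 :=
  h.push (LinearMap.snd ℝ E E')

end PushForward

section Staircase

variable {X Y ι κ : Type*} [LinearOrder ι] [LinearOrder κ] {φ : X → ι} {ψ : Y → κ}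

/-- A staircase: a chain for the product of the orders induced by `φ` and `ψ`. -/
def IsStair (φ : X → ι) (ψ : Y → κ) (C : Finset (X × Y)) : Prop :=
  ∀ p ∈ C, ∀ q ∈ C, (φ p.1 ≤ φ q.1 ∧ ψ p.2 ≤ ψ q.2) ∨ (φ q.1 ≤ φ p.1 ∧ ψ q.2 ≤ ψ p.2)

theorem IsStair.mono {C D : Finset (X × Y)} (h : IsStair φ ψ C) (hDC : D ⊆ C) :
    IsStair φ ψ D :=
  fun p hp q hq => h p (hDC hp) q (hDC hq)

theorem exists_lt_of_not_isStair {C : Finset (X × Y)} (h : ¬ IsStair φ ψ C) :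
    ∃ p ∈ C, ∃ q ∈ C, φ p.1 < φ q.1 ∧ ψ q.2 < ψ p.2 := by
  simp only [IsStair, not_forall, not_or, not_and, not_le] at h
  obtain ⟨p, hp, q, hq, h1, h2⟩ := h
  rcases lt_trichotomy (φ p.1) (φ q.1) with hlt | heq | hgt
  · exact ⟨p, hp, q, hq, hlt, h1 hlt.le⟩
  · exact absurd (h1 heq.le) (h2 heq.ge).asymm
  · exact ⟨q, hq, p, hp, hgt, h2 hgt.le⟩

/-- The lower-left quadrants cut out of a staircase by the two coordinates are nested. -/
theorem IsStair.nested {C : Finset (X × Y)} (h : IsStair φ ψ C) (i : ι) (j : κ) :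
    (∀ q ∈ C, φ q.1 ≤ i → ψ q.2 ≤ j) ∨ (∀ q ∈ C, ψ q.2 ≤ j → φ q.1 ≤ i) := by
  by_contra! hcon
  obtain ⟨⟨p, hp, hp1, hp2⟩, q, hq, hq1, hq2⟩ := hcon
  rcases h p hp q hq with ⟨_, h2⟩ | ⟨h1, _⟩
  · exact absurd (hp2.trans_le h2) hq1.not_gt
  · exact absurd (hq2.trans_le h1) hp1.not_gt

theorem IsStair.quadrant_eq {C : Finset (X × Y)} (h : IsStair φ ψ C) (i : ι) (j : κ) :
    (C.filter fun q => φ q.1 ≤ i ∧ ψ q.2 ≤ j) = (C.filter fun q => φ q.1 ≤ i) ∨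
      (C.filter fun q => φ q.1 ≤ i ∧ ψ q.2 ≤ j) = C.filter fun q => ψ q.2 ≤ j := by
  rcases h.nested i j with h | h
  · exact Or.inl (filter_congr fun q hq => ⟨And.left, fun hi => ⟨hi, h q hq hi⟩⟩)
  · exact Or.inr (filter_congr fun q hq => ⟨And.right, fun hj => ⟨h q hq hj, hj⟩⟩)

/-- The weight of a quadrant is the minimum of the two cumulative marginal weights. -/
theorem IsStair.sum_quadrant {C : Finset (X × Y)} (h : IsStair φ ψ C) {w : X × Y → ℝ}
    (hw : ∀ q, 0 ≤ w q) (i : ι) (j : κ) :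
    ∑ q ∈ C with φ q.1 ≤ i ∧ ψ q.2 ≤ j, w q =
      min (∑ q ∈ C with φ q.1 ≤ i, w q) (∑ q ∈ C with ψ q.2 ≤ j, w q) := by
  have h1 : ∑ q ∈ C with φ q.1 ≤ i ∧ ψ q.2 ≤ j, w q ≤ ∑ q ∈ C with φ q.1 ≤ i, w q :=
    sum_le_sum_of_subset_of_nonneg (monotone_filter_right C fun q _ h => h.1) fun q _ _ => hw q
  have h2 : ∑ q ∈ C with φ q.1 ≤ i ∧ ψ q.2 ≤ j, w q ≤ ∑ q ∈ C with ψ q.2 ≤ j, w q :=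
    sum_le_sum_of_subset_of_nonneg (monotone_filter_right C fun q _ h => h.2) fun q _ _ => hw q
  rcases h.quadrant_eq i j with h | h <;> rw [h] at h1 h2 ⊢
  · exact (min_eq_left h2).symm
  · exact (min_eq_right h1).symm

/-- Weights can be recovered from the weights of the quadrants. -/
theorem mem_of_forall_sum_quadrant_mem (hφ : Function.Injective φ) (hψ : Function.Injective ψ)
    (A : AddSubgroup ℝ) (U : Finset (X × Y)) (w : X × Y → ℝ)
    (h : ∀ p ∈ U, ∑ q ∈ U with φ q.1 ≤ φ p.1 ∧ ψ q.2 ≤ ψ p.2, w q ∈ A) : ∀ p ∈ U, w p ∈ A := by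
  classical
  intro p hp
  induction hn : #(U.filter fun q => φ q.1 ≤ φ p.1 ∧ ψ q.2 ≤ ψ p.2) using
    Nat.strong_induction_on generalizing p with
  | _ n ih =>
    subst hn
    have hpm : p ∈ U.filter fun q => φ q.1 ≤ φ p.1 ∧ ψ q.2 ≤ ψ p.2 :=
      mem_filter.mpr ⟨hp, le_rfl, le_rfl⟩
    have hsum := h p hp
    rw [← add_sum_erase _ _ hpm] at hsum
    refine (A.add_mem_cancel_right (A.sum_mem fun q hq => ?_)).mp hsum
    obtain ⟨hqp, hq⟩ := mem_erase.mp hq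
    obtain ⟨hqU, hq1, hq2⟩ := mem_filter.mp hq
    refine ih _ (card_lt_card ?_) q hqU rfl
    refine ⟨fun r hr => ?_, fun hsub => hqp ?_⟩
    · obtain ⟨hrU, hr1, hr2⟩ := mem_filter.mp hr
      exact mem_filter.mpr ⟨hrU, hr1.trans hq1, hr2.trans hq2⟩
    · obtain ⟨-, hp1, hp2⟩ := mem_filter.mp (hsub hpm)
      exact Prod.ext (hφ (hq1.antisymm hp1)) (hψ (hq2.antisymm hp2))

/-- Weights on a staircase are integral combinations of their marginals. -/
theorem IsStair.mem_of_pushWeight_mem [DecidableEq X] [DecidableEq Y]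
    (hφ : Function.Injective φ) (hψ : Function.Injective ψ) {C : Finset (X × Y)}
    (hC : IsStair φ ψ C) (A : AddSubgroup ℝ) (w : X × Y → ℝ)
    (h1 : ∀ a ∈ C.image Prod.fst, pushWeight Prod.fst C w a ∈ A)
    (h2 : ∀ b ∈ C.image Prod.snd, pushWeight Prod.snd C w b ∈ A) : ∀ p ∈ C, w p ∈ A := by
  refine mem_of_forall_sum_quadrant_mem hφ hψ A C w fun p _ => ?_
  rcases hC.quadrant_eq (φ p.1) (ψ p.2) with h | h <;> rw [h]
  · rw [← sum_filter_pushWeight (subset_refl (C.image Prod.fst)) w fun a => φ a ≤ φ p.1]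
    exact A.sum_mem fun a ha => h1 a (mem_filter.mp ha).1
  · rw [← sum_filter_pushWeight (subset_refl (C.image Prod.snd)) w fun b => ψ b ≤ ψ p.2]
    exact A.sum_mem fun b hb => h2 b (mem_filter.mp hb).1

/-- Nonnegative weights on staircases are determined by their marginals. -/
theorem IsStair.eq_of_pushWeight_eq [DecidableEq X] [DecidableEq Y]
    (hφ : Function.Injective φ) (hψ : Function.Injective ψ) {C D : Finset (X × Y)}
    (hC : IsStair φ ψ C) (hD : IsStair φ ψ D) {w u : X × Y → ℝ}
    (hw : ∀ q, 0 ≤ w q) (hu : ∀ q, 0 ≤ u q) (hwC : ∀ q, q ∉ C → w q = 0)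
    (huD : ∀ q, q ∉ D → u q = 0)
    (h1 : pushWeight Prod.fst C w = pushWeight Prod.fst D u)
    (h2 : pushWeight Prod.snd C w = pushWeight Prod.snd D u) : w = u := by
  have hext : ∀ (B : Finset (X × Y)) (z : X × Y → ℝ), (∀ q, q ∉ B → z q = 0) → B ⊆ C ∪ D →
      ∀ i j, ∑ q ∈ C ∪ D with φ q.1 ≤ i ∧ ψ q.2 ≤ j, z q =
        ∑ q ∈ B with φ q.1 ≤ i ∧ ψ q.2 ≤ j, z q := by
    intro B z hz hB i j
    refine (sum_subset (filter_subset_filter _ hB) fun q hq hqB => hz q fun h => hqB ?_).symm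
    exact mem_filter.mpr ⟨h, (mem_filter.mp hq).2⟩
  have key : ∀ p ∈ C ∪ D, w p - u p ∈ (⊥ : AddSubgroup ℝ) := by
    refine mem_of_forall_sum_quadrant_mem hφ hψ ⊥ (C ∪ D) (fun q => w q - u q) fun p _ => ?_
    rw [AddSubgroup.mem_bot, sum_sub_distrib, hext C w hwC subset_union_left,
      hext D u huD subset_union_right, hC.sum_quadrant hw, hD.sum_quadrant hu,
      ← sum_filter_pushWeight (subset_union_left (s₂ := D.image Prod.fst)) w (fun a => φ a ≤ φ p.1),
      ← sum_filter_pushWeight (subset_union_left (s₂ := D.image Prod.snd)) w (fun b => ψ b ≤ ψ p.2),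
      ← sum_filter_pushWeight (subset_union_right (s₁ := C.image Prod.fst)) u (fun a => φ a ≤ φ p.1),
      ← sum_filter_pushWeight (subset_union_right (s₁ := C.image Prod.snd)) u (fun b => ψ b ≤ ψ p.2),
      h1, h2, sub_self]
  funext p
  by_cases hp : p ∈ C ∪ D
  · exact sub_eq_zero.mp (AddSubgroup.mem_bot.mp (key p hp))
  · rw [mem_union, not_or] at hp
    rw [hwC p hp.1, huD p hp.2]

end Staircase

section NorthWestCorner

variable {X Y ι κ : Type*} [LinearOrder ι] [LinearOrder κ] {φ : X → ι} {ψ : Y → κ}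

theorem sum_le_eq_sum_lt_add (hφ : Function.Injective φ) (F : Finset X) (w : X → ℝ) {a : X}
    (ha : a ∈ F) : ∑ v ∈ F with φ v ≤ φ a, w v = ∑ v ∈ F with φ v < φ a, w v + w a := by
  classical
  have : (F.filter fun v => φ v ≤ φ a) = insert a (F.filter fun v => φ v < φ a) := by
    ext v
    simp only [mem_filter, mem_insert, le_iff_lt_or_eq, hφ.eq_iff]
    aesop
  rw [this, sum_insert (by simp), add_comm]

theorem sum_telescope (hφ : Function.Injective φ) (F : Finset X) (w : X → ℝ) (g : ℝ → ℝ) :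
    ∑ a ∈ F, (g (∑ v ∈ F with φ v ≤ φ a, w v) - g (∑ v ∈ F with φ v < φ a, w v)) =
      g (∑ v ∈ F, w v) - g 0 := by
  classical
  induction F using Finset.induction_on_max_value φ with
  | empty => simp
  | insert a s ha hmax ih =>
    have hlt : ∀ x ∈ s, φ x < φ a := fun x hx =>
      lt_of_le_of_ne (hmax x hx) fun h => ha (hφ h ▸ hx)
    have h1 : ((insert a s).filter fun v => φ v < φ a) = s := by
      rw [filter_insert, if_neg (lt_irrefl _), filter_true_of_mem hlt]
    have h2 : ((insert a s).filter fun v => φ v ≤ φ a) = insert a s :=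
      filter_true_of_mem fun x hx => by
        rcases mem_insert.mp hx with rfl | hx
        exacts [le_rfl, (hlt x hx).le]
    have h3 : ∀ b ∈ s, g (∑ v ∈ insert a s with φ v ≤ φ b, w v) -
        g (∑ v ∈ insert a s with φ v < φ b, w v) =
        g (∑ v ∈ s with φ v ≤ φ b, w v) - g (∑ v ∈ s with φ v < φ b, w v) := fun b hb => by
      rw [filter_insert, if_neg (hlt b hb).not_ge, filter_insert, if_neg (hlt b hb).asymm]
    rw [sum_insert ha, h1, h2, sum_congr rfl h3, ih]
    ring

/-- The mass the north-west corner rule assigns to the product of two intervals. -/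
def overlap (s' s t' t : ℝ) : ℝ := min s t - min s' t - min s t' + min s' t'

theorem overlap_nonneg {s' s t' t : ℝ} (hs : s' ≤ s) (ht : t' ≤ t) : 0 ≤ overlap s' s t' t := by
  unfold overlap
  simp only [min_def]
  split_ifs <;> linarith

theorem lt_of_overlap_pos {s' s t' t : ℝ} (hs : s' ≤ s) (ht : t' ≤ t)
    (h : 0 < overlap s' s t' t) : s' < t ∧ t' < s := by
  unfold overlap at h
  constructor
  · by_contra! hle
    rw [min_eq_right hle, min_eq_right (hle.trans hs), min_eq_right (ht.trans hle),
      min_eq_right ((ht.trans hle).trans hs)] at h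
    linarith
  · by_contra! hle
    rw [min_eq_left hle, min_eq_left (hle.trans ht), min_eq_left (hs.trans hle),
      min_eq_left ((hs.trans hle).trans ht)] at h
    linarith

theorem sum_overlap (hψ : Function.Injective ψ) {F : Finset Y} {w : Y → ℝ}
    (hw1 : ∑ v ∈ F, w v = 1) {s' s : ℝ} (h0 : 0 ≤ s') (hs : s' ≤ s) (h1 : s ≤ 1) :
    ∑ b ∈ F, overlap s' s (∑ v ∈ F with ψ v < ψ b, w v) (∑ v ∈ F with ψ v ≤ ψ b, w v) =
      s - s' := by
  have := sum_telescope hψ F w fun t => min s t - min s' t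
  rw [hw1, min_eq_left h1, min_eq_left (hs.trans h1), min_eq_right (h0.trans hs),
    min_eq_right h0, sub_self, sub_zero] at this
  rw [← this]
  exact sum_congr rfl fun b _ => by unfold overlap; ring

theorem overlap_swap (s' s t' t : ℝ) : overlap s' s t' t = overlap t' t s' s := by
  unfold overlap
  rw [min_comm s t, min_comm s' t, min_comm s t', min_comm s' t']
  ring

/-- Two systems of convex weights can be coupled along a staircase. -/
theorem exists_isBary_stair {E E' : Type*} [AddCommGroup E] [Module ℝ E] [AddCommGroup E']
    [Module ℝ E'] {φ : E → ι} {ψ : E' → κ} (hφ : Function.Injective φ)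
    (hψ : Function.Injective ψ) {F : Finset E} {G : Finset E'} {w : E → ℝ} {u : E' → ℝ} {x : E}
    {y : E'} (hw : IsBary F w x) (hu : IsBary G u y) :
    ∃ C ⊆ F ×ˢ G, IsStair φ ψ C ∧ ∃ c, IsBary C c (x, y) := by
  classical
  let s : E → ℝ := fun a => ∑ v ∈ F with φ v ≤ φ a, w v
  let s' : E → ℝ := fun a => ∑ v ∈ F with φ v < φ a, w v
  let t : E' → ℝ := fun b => ∑ v ∈ G with ψ v ≤ ψ b, u v
  let t' : E' → ℝ := fun b => ∑ v ∈ G with ψ v < ψ b, u v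
  have hs : ∀ a, s' a ≤ s a := fun a => sum_le_sum_of_subset_of_nonneg
    (monotone_filter_right F fun v _ h => h.le) fun v _ _ => hw.1 v
  have ht : ∀ b, t' b ≤ t b := fun b => sum_le_sum_of_subset_of_nonneg
    (monotone_filter_right G fun v _ h => h.le) fun v _ _ => hu.1 v
  have hs0 : ∀ a, 0 ≤ s' a := fun a => sum_nonneg fun v _ => hw.1 v
  have ht0 : ∀ b, 0 ≤ t' b := fun b => sum_nonneg fun v _ => hu.1 v
  have hs1 : ∀ a, s a ≤ 1 := fun a => hw.2.2.1 ▸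
    sum_le_sum_of_subset_of_nonneg (filter_subset _ F) fun v _ _ => hw.1 v
  have ht1 : ∀ b, t b ≤ 1 := fun b => hu.2.2.1 ▸
    sum_le_sum_of_subset_of_nonneg (filter_subset _ G) fun v _ _ => hu.1 v
  have hslt : ∀ a b, φ a < φ b → s a ≤ s' b := fun a b hab => sum_le_sum_of_subset_of_nonneg
    (monotone_filter_right F fun v _ h => lt_of_le_of_lt h hab) fun v _ _ => hw.1 v
  have htlt : ∀ a b, ψ a < ψ b → t a ≤ t' b := fun a b hab => sum_le_sum_of_subset_of_nonneg
    (monotone_filter_right G fun v _ h => lt_of_le_of_lt h hab) fun v _ _ => hu.1 v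
  let c : E × E' → ℝ := fun p => overlap (s' p.1) (s p.1) (t' p.2) (t p.2)
  have hc : ∀ p, 0 ≤ c p := fun p => overlap_nonneg (hs p.1) (ht p.2)
  have hrow : ∀ a ∈ F, ∑ b ∈ G, c (a, b) = w a := fun a ha => by
    rw [sum_overlap hψ hu.2.2.1 (hs0 a) (hs a) (hs1 a), sub_eq_iff_eq_add']
    exact sum_le_eq_sum_lt_add hφ F w ha
  have hcol : ∀ b ∈ G, ∑ a ∈ F, c (a, b) = u b := fun b hb => by
    simp only [c, overlap_swap (s' _)]
    rw [sum_overlap hφ hw.2.2.1 (ht0 b) (ht b) (ht1 b), sub_eq_iff_eq_add']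
    exact sum_le_eq_sum_lt_add hψ G u hb
  let C := (F ×ˢ G).filter fun p => 0 < c p
  have hCsub : C ⊆ F ×ˢ G := filter_subset _ _
  have hoff : ∀ p ∈ F ×ˢ G, p ∉ C → c p = 0 := fun p hp hpC =>
    le_antisymm (not_lt.mp fun h => hpC (mem_filter.mpr ⟨hp, h⟩)) (hc p)
  refine ⟨C, hCsub, ?_, fun p => if p ∈ C then c p else 0, fun p => ?_, fun p hp => if_neg hp,
    ?_, ?_⟩
  · by_contra hst
    obtain ⟨p, hp, q, hq, h1, h2⟩ := exists_lt_of_not_isStair hst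
    have hp' := lt_of_overlap_pos (hs p.1) (ht p.2) (mem_filter.mp hp).2
    have hq' := lt_of_overlap_pos (hs q.1) (ht q.2) (mem_filter.mp hq).2
    have := hslt _ _ h1
    have := htlt _ _ h2
    linarith
  · dsimp only
    split_ifs
    exacts [hc p, le_rfl]
  · rw [sum_congr rfl fun p hp => if_pos hp, sum_subset hCsub hoff, sum_product,
      sum_congr rfl hrow, hw.2.2.1]
  · have h : ∑ p ∈ C, (if p ∈ C then c p else 0) • p = ∑ p ∈ F ×ˢ G, c p • p := by
      rw [← sum_subset hCsub fun p hp hpC => by rw [hoff p hp hpC, zero_smul]]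
      exact sum_congr rfl fun p hp => by rw [if_pos hp]
    rw [h]
    refine Prod.ext ?_ ?_
    · rw [Prod.fst_sum, sum_product, ← hw.2.2.2]
      refine sum_congr rfl fun a ha => ?_
      rw [← hrow a ha, sum_smul]
      rfl
    · rw [Prod.snd_sum, sum_product_right, ← hu.2.2.2]
      refine sum_congr rfl fun b hb => ?_
      rw [← hcol b hb, sum_smul]
      rfl

end NorthWestCorner

/-- The affine coordinates of a lattice point in a face of a unimodular cell are integers. -/
theorem UnimodularFinset.weight_mem_intCast {E : Type*} [AddCommGroup E] [Module ℝ E]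
    {L : E → Prop} {G F : Finset E}
    (hG : UnimodularFinset L G) (hFG : F ⊆ G) {w : E → ℝ} (hw : ∀ v, v ∉ F → w v = 0)
    (hw1 : ∑ v ∈ F, w v = 1) (hL : L (∑ v ∈ F, w v • v)) (v : E) (hv : v ∈ F) :
    w v ∈ (Int.castAddHom ℝ).range := by
  have h1 : ∑ v ∈ G, w v = 1 := hw1 ▸ (sum_subset hFG fun v _ hv => hw v hv).symm
  have h2 : ∑ v ∈ G, w v • v = ∑ v ∈ F, w v • v :=
    (sum_subset hFG fun v _ hv => by rw [hw v hv, zero_smul]).symm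
  have hspan : ∑ v ∈ F, w v • v ∈ affineSpan ℝ (G : Set E) := by
    rw [← h2, ← affineCombination_eq_linear_combination G (fun v => v) w h1]
    have := affineCombination_mem_affineSpan_image h1 (fun v hv hv' => absurd hv hv')
      (p := fun v : E => v) (s' := (G : Set E))
    simpa using this
  obtain ⟨c, -, hc1, hc⟩ := hG.2.2 _ hL hspan
  refine ⟨c v, (hG.2.1.eq_weights ?_ (h2.trans hc.symm) v (hFG hv)).symm⟩
  rw [h1]
  exact_mod_cast hc1.symm

section Product

variable {E E' ι κ : Type*} [DecidableEq E] [DecidableEq E'] [LinearOrder ι] [LinearOrder κ]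
  {φ : E → ι} {ψ : E' → κ} {T : Finset (Finset E)} {T' : Finset (Finset E')}

open scoped Classical in
/-- The staircase refinement of the product of two triangulations. -/
noncomputable def stairProduct (φ : E → ι) (ψ : E' → κ) (T : Finset (Finset E))
    (T' : Finset (Finset E')) : Finset (Finset (E × E')) :=
  (T.biUnion id ×ˢ T'.biUnion id).powerset.filter fun C =>
    C.image Prod.fst ∈ T ∧ C.image Prod.snd ∈ T' ∧ IsStair φ ψ C

theorem mem_stairProduct {C : Finset (E × E')} :
    C ∈ stairProduct φ ψ T T' ↔ C.image Prod.fst ∈ T ∧ C.image Prod.snd ∈ T' ∧ IsStair φ ψ C := by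
  classical
  unfold stairProduct
  rw [mem_filter, and_iff_right_iff_imp, mem_powerset]
  rintro ⟨h1, h2, -⟩ p hp
  exact mem_product.mpr ⟨mem_biUnion.mpr ⟨_, h1, mem_image_of_mem _ hp⟩,
    mem_biUnion.mpr ⟨_, h2, mem_image_of_mem _ hp⟩⟩

theorem stairProduct_mono (hT : ∀ F ∈ T, ∀ G, G ⊆ F → G ∈ T)
    (hT' : ∀ F ∈ T', ∀ G, G ⊆ F → G ∈ T') {C D : Finset (E × E')}
    (hC : C ∈ stairProduct φ ψ T T') (hDC : D ⊆ C) : D ∈ stairProduct φ ψ T T' := by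
  rw [mem_stairProduct] at hC ⊢
  exact ⟨hT _ hC.1 _ (image_subset_image hDC), hT' _ hC.2.1 _ (image_subset_image hDC),
    hC.2.2.mono hDC⟩

/-- If the image of a minimal non-face is not a face, the non-face lifts a minimal one. -/
theorem MinNonFace.exists_lift {X Y : Type*} [DecidableEq X] [DecidableEq Y] {S : Finset (Finset X)}
    {R : Finset (Finset Y)} (π : X → Y) (hS : ∀ C ∈ S, C.image π ∈ R) {N : Finset X}
    (hN : MinNonFace S N) (hNR : N.image π ∉ R) :
    ∃ M, MinNonFace R M ∧ N.image π = M ∧ #N = #M := by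
  have hmin : ∀ L ⊆ N, L.image π ∉ R → L = N := fun L hL hLR => by
    by_contra hne
    exact hLR (hS L (hN.2.2 L (hL.ssubset_of_ne hne)))
  have hinj : Set.InjOn π N := by
    intro q hq q' hq' h
    by_contra hne
    have himg : (N.erase q).image π = N.image π := by
      refine (image_subset_image (erase_subset q N)).antisymm fun y hy => ?_
      obtain ⟨r, hr, rfl⟩ := mem_image.mp hy
      by_cases hrq : r = q
      · exact mem_image.mpr ⟨q', mem_erase.mpr ⟨Ne.symm hne, hq'⟩, by rw [hrq, h]⟩
      · exact mem_image_of_mem π (mem_erase.mpr ⟨hrq, hr⟩)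
    exact erase_eq_self.mp (hmin _ (erase_subset q N) (by rwa [himg])) hq
  refine ⟨N.image π, ⟨fun y hy => ?_, hNR, fun M hM => ?_⟩, rfl, (card_image_of_injOn hinj).symm⟩
  · obtain ⟨q, hq, rfl⟩ := mem_image.mp hy
    simpa using hS _ (hN.1 q hq)
  · by_contra hMR
    have hsub : N.filter (fun q => π q ∈ M) ⊆ N := filter_subset _ _
    have himg : (N.filter fun q => π q ∈ M).image π = M := by
      ext y
      simp only [mem_image, mem_filter]
      refine ⟨fun ⟨q, ⟨_, hq⟩, h⟩ => h ▸ hq, fun hy => ?_⟩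
      obtain ⟨q, hq, rfl⟩ := mem_image.mp (hM.1 hy)
      exact ⟨q, ⟨hq, hy⟩, rfl⟩
    have := hmin _ hsub (by rwa [himg])
    rw [this] at himg
    exact hM.ne himg.symm

theorem stairProduct_minNonFace {N : Finset (E × E')}
    (hN : MinNonFace (stairProduct φ ψ T T') N) :
    #N = 2 ∨ (∃ M, MinNonFace T M ∧ N.image Prod.fst = M ∧ #N = #M) ∨
      ∃ M, MinNonFace T' M ∧ N.image Prod.snd = M ∧ #N = #M := by
  by_cases h1 : N.image Prod.fst ∈ T
  swap
  · exact Or.inr (Or.inl (hN.exists_lift _ (fun C hC => (mem_stairProduct.mp hC).1) h1))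
  by_cases h2 : N.image Prod.snd ∈ T'
  swap
  · exact Or.inr (Or.inr (hN.exists_lift _ (fun C hC => (mem_stairProduct.mp hC).2.1) h2))
  left
  obtain ⟨p, hp, q, hq, hpq, hqp⟩ := exists_lt_of_not_isStair fun h3 =>
    hN.2.1 (mem_stairProduct.mpr ⟨h1, h2, h3⟩)
  have hne : p ≠ q := fun h => hpq.ne (h ▸ rfl)
  have hsub : {p, q} ⊆ N := by
    intro r hr
    rcases mem_insert.mp hr with rfl | hr
    exacts [hp, mem_singleton.mp hr ▸ hq]
  rw [← card_pair hne]
  by_contra hcard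
  have hface := hN.2.2 {p, q} (hsub.ssubset_of_ne fun h => hcard (h ▸ rfl))
  rcases (mem_stairProduct.mp hface).2.2 p (by simp) q (by simp) with h | h
  · exact h.2.not_gt hqp
  · exact h.1.not_gt hpq

variable [AddCommGroup E] [Module ℝ E] [AddCommGroup E'] [Module ℝ E'] {P : Set E} {P' : Set E'}

theorem stairProduct_affineIndependent (hφ : Function.Injective φ) (hψ : Function.Injective ψ)
    (hT : IsTriangulation P T) (hT' : IsTriangulation P' T') {C : Finset (E × E')}
    (hC : C ∈ stairProduct φ ψ T T') : AffineIndependent ℝ (fun p : C => (p : E × E')) := by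
  rw [mem_stairProduct] at hC
  rw [affineIndependent_finset_iff]
  intro w h0 h1
  refine hC.2.2.mem_of_pushWeight_mem hφ hψ ⊥ w ?_ ?_
  · refine affineIndependent_finset_iff.mp (hT.1 _ hC.1) _ ?_ ?_
    · rw [sum_pushWeight subset_rfl, h0]
    · rw [sum_pushWeight_smul subset_rfl]
      simpa [Prod.fst_sum] using congrArg Prod.fst h1
  · refine affineIndependent_finset_iff.mp (hT'.1 _ hC.2.1) _ ?_ ?_
    · rw [sum_pushWeight subset_rfl, h0]
    · rw [sum_pushWeight_smul subset_rfl]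
      simpa [Prod.snd_sum] using congrArg Prod.snd h1

theorem stairProduct_isTriangulation (hφ : Function.Injective φ) (hψ : Function.Injective ψ)
    (hT : IsTriangulation P T) (hT' : IsTriangulation P' T') :
    IsTriangulation (P ×ˢ P') (stairProduct φ ψ T T') := by
  refine isTriangulation_of_bary_unique
    (fun C hC => stairProduct_affineIndependent hφ hψ hT hT' hC)
    (fun C hC D hDC => stairProduct_mono hT.2.1 hT'.2.1 hC hDC) ?_ ?_
  · intro C hC D hD w u x hw hu
    rw [mem_stairProduct] at hC hD
    exact hC.2.2.eq_of_pushWeight_eq hφ hψ hD.2.2 hw.1 hu.1 hw.2.1 hu.2.1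
      (hT.bary_unique hC.1 hD.1 hw.fst hu.fst) (hT'.bary_unique hC.2.1 hD.2.1 hw.snd hu.snd)
  · rintro ⟨x, y⟩
    rw [Set.mem_prod, hT.mem_iff, hT'.mem_iff]
    constructor
    · rintro ⟨⟨F, hF, w, hw⟩, G, hG, u, hu⟩
      obtain ⟨C, hC, hst, c, hc⟩ := exists_isBary_stair hφ hψ hw hu
      refine ⟨C, mem_stairProduct.mpr ⟨hT.2.1 F hF _ ?_, hT'.2.1 G hG _ ?_, hst⟩, c, hc⟩
      · exact image_subset_iff.mpr fun p hp => (mem_product.mp (hC hp)).1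
      · exact image_subset_iff.mpr fun p hp => (mem_product.mp (hC hp)).2
    · rintro ⟨C, hC, c, hc⟩
      rw [mem_stairProduct] at hC
      exact ⟨⟨_, hC.1, _, hc.fst⟩, _, hC.2.1, _, hc.snd⟩

theorem stairProduct_isUnimodular (hφ : Function.Injective φ) (hψ : Function.Injective ψ)
    (hT : IsTriangulation P T) (hT' : IsTriangulation P' T') {L : E → Prop} {L' : E' → Prop}
    (hL : IsUnimodular L T) (hL' : IsUnimodular L' T') :
    IsUnimodular (fun x => L x.1 ∧ L' x.2) (stairProduct φ ψ T T') := by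
  rintro C ⟨hC, -⟩
  have hind := stairProduct_affineIndependent hφ hψ hT hT' hC
  rw [mem_stairProduct] at hC
  obtain ⟨G, hG, hCG⟩ := exists_maxCell hC.1
  obtain ⟨G', hG', hCG'⟩ := exists_maxCell hC.2.1
  refine ⟨fun p hp => ⟨(hL G hG).1 _ (hCG (mem_image_of_mem _ hp)),
    (hL' G' hG').1 _ (hCG' (mem_image_of_mem _ hp))⟩, hind, fun x hx hxC => ?_⟩
  obtain ⟨w, hw1, rfl⟩ := exists_weights_of_mem_affineSpan hxC
  have hint : ∀ p ∈ C, w p ∈ (Int.castAddHom ℝ).range := by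
    refine hC.2.2.mem_of_pushWeight_mem hφ hψ _ w ?_ ?_
    · refine (hL G hG).weight_mem_intCast hCG (fun v => pushWeight_eq_zero w)
        ((sum_pushWeight subset_rfl w).trans hw1) ?_
      rw [sum_pushWeight_smul subset_rfl]
      simpa [Prod.fst_sum] using hx.1
    · refine (hL' G' hG').weight_mem_intCast hCG' (fun v => pushWeight_eq_zero w)
        ((sum_pushWeight subset_rfl w).trans hw1) ?_
      rw [sum_pushWeight_smul subset_rfl]
      simpa [Prod.snd_sum] using hx.2
  choose! c hc using hint
  simp only [Int.coe_castAddHom] at hc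
  refine ⟨fun p => if p ∈ C then c p else 0, fun p hp => if_neg hp, ?_, ?_⟩
  · rw [sum_congr rfl fun p hp => if_pos hp]
    have : ((∑ p ∈ C, c p : ℤ) : ℝ) = 1 := by
      rw [Int.cast_sum, sum_congr rfl hc, hw1]
    exact_mod_cast this
  · exact sum_congr rfl fun p hp => by simp only [if_pos hp, hc p hp]

end Product

section Assembly

theorem IsRegularWitness.affineOnFaces {E : Type*} [NormedAddCommGroup E] [NormedSpace ℝ E]
    {P : Set E} {T : Finset (Finset E)} {f : E → ℝ} {g : Finset E → E →ᵃ[ℝ] ℝ}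
    (h : IsRegularWitness P T f g) : AffineOnFaces T f := by
  intro F hF w x hw
  obtain ⟨G, hG, hFG⟩ := exists_maxCell hF
  have hFG' : convexHull ℝ (F : Set E) ⊆ convexHull ℝ (G : Set E) := convexHull_mono hFG
  rw [h.2.1 G hG (hFG' (mem_convexHull_iff_exists_isBary.mpr ⟨w, hw⟩)), (g G).map_isBary hw]
  exact sum_congr rfl fun v hv => by rw [h.2.1 G hG (hFG' (subset_convexHull ℝ _ hv))]

/-- A convex function which is affine on the faces certifies regularity as soon as Jensen's
equality forces a set of vertices to be a face. -/
theorem IsTriangulation.isRegularTri_of_jensen {E : Type*} [NormedAddCommGroup E]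
    [NormedSpace ℝ E] {P : Set E} {T : Finset (Finset E)} (hT : IsTriangulation P T)
    {f : E → ℝ} (hf : ConvexOn ℝ P f) (hfT : AffineOnFaces T f)
    (h : ∀ (U : Finset E) (w : E → ℝ), (∀ p ∈ U, {p} ∈ T) → (∀ p ∈ U, 0 < w p) →
      ∑ p ∈ U, w p = 1 → f (∑ p ∈ U, w p • p) = ∑ p ∈ U, w p * f p → U ∈ T) :
    IsRegularTri P T := by
  classical
  refine ⟨f, hf, fun F hF => ?_, ?_⟩
  · obtain ⟨g, hg⟩ := (hT.1 F hF.1).exists_affineMap f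
    refine ⟨g, fun x hx => ?_⟩
    obtain ⟨w, hw⟩ := mem_convexHull_iff_exists_isBary.mp hx
    rw [hfT F hF.1 w x hw, g.map_isBary hw]
    exact sum_congr rfl fun v hv => by rw [hg v hv]
  · rintro F G hF hG hne ⟨g, hg⟩
    have hgU : ∀ p ∈ F ∪ G, f p = g p := fun p hp => by
      refine hg ?_
      rcases mem_union.mp hp with hp | hp
      exacts [Or.inl (subset_convexHull ℝ _ hp), Or.inr (subset_convexHull ℝ _ hp)]
    have hvert : ∀ p ∈ F ∪ G, {p} ∈ T := fun p hp => by
      rcases mem_union.mp hp with hp | hp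
      exacts [hT.2.1 F hF.1 _ (singleton_subset_iff.mpr hp),
        hT.2.1 G hG.1 _ (singleton_subset_iff.mpr hp)]
    have hvP : ∀ p ∈ F ∪ G, p ∈ P := fun p hp =>
      hT.mem_of_mem_face (hvert p hp) (mem_singleton_self p)
    have hUne : (F ∪ G).Nonempty := by
      by_contra hU
      rw [not_nonempty_iff_eq_empty, union_eq_empty] at hU
      exact hne (hU.1.trans hU.2.symm)
    have hc : (0 : ℝ) < #(F ∪ G) := by exact_mod_cast hUne.card_pos
    have hw1 : ∑ p ∈ F ∪ G, (#(F ∪ G) : ℝ)⁻¹ = 1 := by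
      rw [sum_const, nsmul_eq_mul, mul_inv_cancel₀ hc.ne']
    have hgm : g (∑ p ∈ F ∪ G, (#(F ∪ G) : ℝ)⁻¹ • p) =
        ∑ p ∈ F ∪ G, (#(F ∪ G) : ℝ)⁻¹ * g p := by
      have := (F ∪ G).map_affineCombination (fun p => p) (fun _ => (#(F ∪ G) : ℝ)⁻¹) hw1 g
      rw [affineCombination_eq_linear_combination _ _ _ hw1,
        affineCombination_eq_linear_combination _ _ _ hw1] at this
      simpa using this
    have hmem := h (F ∪ G) (fun _ => (#(F ∪ G) : ℝ)⁻¹) hvert (fun _ _ => inv_pos.mpr hc) hw1 <| by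
      refine le_antisymm (hf.map_sum_le (fun _ _ => (inv_pos.mpr hc).le) hw1 hvP) ?_
      rw [sum_congr rfl fun p hp => by rw [hgU p hp], ← hgm]
      exact hF.le_of_convexOn hT hf (fun x hx => hg (Or.inl hx))
        (hf.1.sum_mem (fun _ _ => (inv_pos.mpr hc).le) hw1 hvP)
    exact hne ((hF.2 _ hmem subset_union_left).symm.trans (hG.2 _ hmem subset_union_right))

theorem IsRegularWitness.exists_threshold {E ι : Type*} [NormedAddCommGroup E] [NormedSpace ℝ E]
    [LinearOrder ι] {P : Set E} {T : Finset (Finset E)} (hT : IsTriangulation P T) {f : E → ℝ}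
    {g : Finset E → E →ᵃ[ℝ] ℝ} (h : IsRegularWitness P T f g) (φ : E → ι) (i : ι) :
    ∃ (K : ℝ) (k : E → ℝ), 0 ≤ K ∧ AffineOnFaces T k ∧
      (∀ v, {v} ∈ T → k v = if φ v ≤ i then 1 else 0) ∧ ConvexOn ℝ P fun x => K * f x - k x := by
  obtain ⟨k, hk, hkv⟩ := hT.exists_affineOnFaces fun v => if φ v ≤ i then 1 else 0
  obtain ⟨K, hK, hconv⟩ := h.exists_convexOn_add hT (k := fun x => - k x) fun F hF w x hw => by
    simp only [mul_neg, sum_neg_distrib, hk F hF w x hw]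
  exact ⟨K, k, hK, hk, hkv, by simpa only [sub_eq_add_neg] using hconv⟩

theorem AffineOnFaces.sum_comp {E X : Type*} [AddCommGroup E] [Module ℝ E] [DecidableEq E]
    {T : Finset (Finset E)} {k : E → ℝ} (hk : AffineOnFaces T k) {π : X → E} {C : Finset X}
    (hC : C.image π ∈ T) {c : X → ℝ} {x : E} (hc : IsBary (C.image π) (pushWeight π C c) x) :
    k x = ∑ q ∈ C, c q * k (π q) := by
  rw [hk _ hC _ _ hc]
  simpa only [smul_eq_mul] using sum_pushWeight_smul subset_rfl c k

/-- The function `K f + K' f' - min (k, k')` is convex when `K f - k` and `K' f' - k'` are. -/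
theorem ConvexOn.sub_min {E : Type*} [AddCommGroup E] [Module ℝ E] {P : Set E}
    {F F' k k' : E → ℝ} (hF : ConvexOn ℝ P F) (hF' : ConvexOn ℝ P F')
    (h : ConvexOn ℝ P fun x => F x - k x) (h' : ConvexOn ℝ P fun x => F' x - k' x) :
    ConvexOn ℝ P fun x => F x + F' x - min (k x) (k' x) := by
  refine ((h.add hF').sup (hF.add h')).congr fun x _ => ?_
  simp only [Pi.sup_apply, Pi.add_apply]
  rcases le_total (k x) (k' x) with hk | hk
  · rw [min_eq_left hk, sup_eq_left.mpr (by linarith)]; ring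
  · rw [min_eq_right hk, sup_eq_right.mpr (by linarith)]; ring

variable {E E' ι κ : Type*} [NormedAddCommGroup E] [NormedSpace ℝ E] [NormedAddCommGroup E']
  [NormedSpace ℝ E'] [DecidableEq E] [DecidableEq E'] [LinearOrder ι] [LinearOrder κ]
  {φ : E → ι} {ψ : E' → κ} {T : Finset (Finset E)} {T' : Finset (Finset E')} {P : Set E}
  {P' : Set E'}

theorem stairProduct_isRegularTri (hφ : Function.Injective φ) (hψ : Function.Injective ψ)
    (hT : IsTriangulation P T) (hT' : IsTriangulation P' T') (hr : IsRegularTri P T)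
    (hr' : IsRegularTri P' T') : IsRegularTri (P ×ˢ P') (stairProduct φ ψ T T') := by
  obtain ⟨f, g, hfg⟩ := hr.exists_witness
  obtain ⟨f', g', hfg'⟩ := hr'.exists_witness
  choose K k hK hk hkv hconv using fun a => hfg.exists_threshold hT φ (φ a)
  choose K' k' hK' hk' hkv' hconv' using fun b => hfg'.exists_threshold hT' ψ (ψ b)
  have hPP : Convex ℝ (P ×ˢ P') := hfg.1.1.prod hfg'.1.1
  have liftFst : ∀ {u : E → ℝ}, ConvexOn ℝ P u → ConvexOn ℝ (P ×ˢ P') fun z => u z.1 :=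
    fun hu => (hu.comp_linearMap (LinearMap.fst ℝ E E')).subset (fun z hz => hz.1) hPP
  have liftSnd : ∀ {u : E' → ℝ}, ConvexOn ℝ P' u → ConvexOn ℝ (P ×ˢ P') fun z => u z.2 :=
    fun hu => (hu.comp_linearMap (LinearMap.snd ℝ E E')).subset (fun z hz => hz.2) hPP
  let m : E × E' → E × E' → ℝ := fun j z => min (k j.1 z.1) (k' j.2 z.2)
  let h : E × E' → E × E' → ℝ := fun j z => K j.1 * f z.1 + K' j.2 * f' z.2 - m j z
  let J := T.biUnion id ×ˢ T'.biUnion id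
  have hf1 := liftFst hfg.1
  have hf2 := liftSnd hfg'.1
  have hh : ∀ j, ConvexOn ℝ (P ×ˢ P') (h j) := fun j =>
    ConvexOn.sub_min (liftFst (hfg.1.smul (hK j.1))) (liftSnd (hfg'.1.smul (hK' j.2)))
      (liftFst (hconv j.1)) (liftSnd (hconv' j.2))
  have hsum : ConvexOn ℝ (P ×ˢ P') fun z => ∑ j ∈ J, h j z := by
    have : ∀ J : Finset (E × E'), ConvexOn ℝ (P ×ˢ P') fun z => ∑ j ∈ J, h j z := fun J => by
      induction J using Finset.induction_on with
      | empty => simpa using convexOn_const 0 hPP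
      | insert a s ha ih => simp only [sum_insert ha]; exact (hh a).add ih
    exact this J
  have hm : ∀ p : E × E', {p.1} ∈ T → {p.2} ∈ T' → ∀ j,
      m j p = if φ p.1 ≤ φ j.1 ∧ ψ p.2 ≤ ψ j.2 then 1 else 0 := fun p h1 h2 j => by
    simp only [m, hkv _ _ h1, hkv' _ _ h2]
    split_ifs <;> simp_all
  have hvert : ∀ {C : Finset (E × E')}, C.image Prod.fst ∈ T → C.image Prod.snd ∈ T' → ∀ p ∈ C,
      {p.1} ∈ T ∧ {p.2} ∈ T' := fun h1 h2 p hp =>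
    ⟨hT.2.1 _ h1 _ (singleton_subset_iff.mpr (mem_image_of_mem _ hp)),
      hT'.2.1 _ h2 _ (singleton_subset_iff.mpr (mem_image_of_mem _ hp))⟩
  have hmaff : ∀ j, AffineOnFaces (stairProduct φ ψ T T') (m j) := fun j C hC c z hc => by
    obtain ⟨h1, h2, h3⟩ := mem_stairProduct.mp hC
    have w1 : ∑ q ∈ C, c q * k j.1 q.1 = ∑ q ∈ C with φ q.1 ≤ φ j.1, c q := by
      rw [sum_filter]
      exact sum_congr rfl fun q hq => by
        rw [hkv _ _ (hvert h1 h2 q hq).1, mul_ite, mul_one, mul_zero]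
    have w2 : ∑ q ∈ C, c q * k' j.2 q.2 = ∑ q ∈ C with ψ q.2 ≤ ψ j.2, c q := by
      rw [sum_filter]
      exact sum_congr rfl fun q hq => by
        rw [hkv' _ _ (hvert h1 h2 q hq).2, mul_ite, mul_one, mul_zero]
    have w3 : m j z = min (∑ q ∈ C, c q * k j.1 q.1) (∑ q ∈ C, c q * k' j.2 q.2) := by
      rw [← (hk j.1).sum_comp h1 hc.fst, ← (hk' j.2).sum_comp h2 hc.snd]
    rw [w3, w1, w2, ← h3.sum_quadrant hc.1, sum_filter]
    exact sum_congr rfl fun q hq => by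
      rw [hm q (hvert h1 h2 q hq).1 (hvert h1 h2 q hq).2, mul_ite, mul_one, mul_zero]
  refine (stairProduct_isTriangulation hφ hψ hT hT').isRegularTri_of_jensen
    (f := fun z => f z.1 + f' z.2 + ∑ j ∈ J, h j z) ((hf1.add hf2).add hsum) ?_ ?_
  · intro C hC c z hc
    obtain ⟨h1, h2, h3⟩ := mem_stairProduct.mp hC
    have hF := hfg.affineOnFaces.sum_comp h1 hc.fst
    have hF' := hfg'.affineOnFaces.sum_comp h2 hc.snd
    have hhC : ∀ j, h j z = ∑ q ∈ C, c q * h j q := fun j => by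
      simp only [h, mul_sub, mul_add, sum_sub_distrib, sum_add_distrib]
      rw [← hmaff j C hC c z hc, hF, hF', mul_sum, mul_sum]
      congr 2 <;> exact sum_congr rfl fun q _ => by ring
    simp only [mul_add, sum_add_distrib, mul_sum]
    rw [sum_comm, ← sum_congr rfl fun j _ => hhC j, hF, hF']
  · intro U w hU hw hw1 heq
    have hUT : ∀ p ∈ U, {p.1} ∈ T ∧ {p.2} ∈ T' := fun p hp => by
      simpa using And.intro (mem_stairProduct.mp (hU p hp)).1 (mem_stairProduct.mp (hU p hp)).2.1
    have hUP : ∀ p ∈ U, p ∈ P ×ˢ P' := fun p hp =>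
      ⟨hT.mem_of_mem_face (hUT p hp).1 (mem_singleton_self _),
        hT'.mem_of_mem_face (hUT p hp).2 (mem_singleton_self _)⟩
    have jensen : ∀ {u : E × E' → ℝ}, ConvexOn ℝ (P ×ˢ P') u →
        u (∑ p ∈ U, w p • p) ≤ ∑ p ∈ U, w p * u p := fun hu =>
      hu.map_sum_le (fun p hp => (hw p hp).le) hw1 hUP
    have j1 := jensen hf1
    have j2 := jensen hf2
    have j3 : ∀ j ∈ J, _ := fun j _ => jensen (hh j)
    have j4 := sum_le_sum j3
    have hexp : ∑ p ∈ U, w p * (f p.1 + f' p.2 + ∑ j ∈ J, h j p) = ∑ p ∈ U, w p * f p.1 +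
        ∑ p ∈ U, w p * f' p.2 + ∑ j ∈ J, ∑ p ∈ U, w p * h j p := by
      simp only [mul_add, sum_add_distrib, mul_sum]
      rw [sum_comm]
    rw [hexp] at heq
    have e1 : f (∑ p ∈ U, w p • p).1 = ∑ p ∈ U, w p * f p.1 := by linarith
    have e2 : f' (∑ p ∈ U, w p • p).2 = ∑ p ∈ U, w p * f' p.2 := by linarith
    have e3 := (sum_eq_sum_iff_of_le j3).mp (by linarith)
    have i1 : U.image Prod.fst ∈ T := hfg.image_mem_of_jensen_eq hT hw hw1
      (fun p hp => (hUT p hp).1) (by simpa [Prod.fst_sum] using e1)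
    have i2 : U.image Prod.snd ∈ T' := hfg'.image_mem_of_jensen_eq hT' hw hw1
      (fun p hp => (hUT p hp).2) (by simpa [Prod.snd_sum] using e2)
    refine mem_stairProduct.mpr ⟨i1, i2, ?_⟩
    by_contra hst
    obtain ⟨p, hp, q, hq, hpq, hqp⟩ := exists_lt_of_not_isStair hst
    have hbary : IsBary U (fun r => if r ∈ U then w r else 0) (∑ r ∈ U, w r • r) := by
      refine ⟨fun r => ?_, fun r hr => if_neg hr, ?_, ?_⟩
      · dsimp only
        split_ifs with hr
        exacts [(hw r hr).le, le_rfl]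
      · rw [← hw1]
        exact sum_congr rfl fun r hr => if_pos hr
      · exact sum_congr rfl fun r hr => by simp only [if_pos hr]
    have s1 : k p.1 (∑ r ∈ U, w r • r).1 = ∑ r ∈ U, w r * k p.1 r.1 :=
      ((hk p.1).sum_comp i1 hbary.fst).trans (sum_congr rfl fun r hr => by rw [if_pos hr])
    have s2 : k' q.2 (∑ r ∈ U, w r • r).2 = ∑ r ∈ U, w r * k' q.2 r.2 :=
      ((hk' q.2).sum_comp i2 hbary.snd).trans (sum_congr rfl fun r hr => by rw [if_pos hr])
    have hj : (p.1, q.2) ∈ J := mem_product.mpr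
      ⟨mem_biUnion.mpr ⟨_, (hUT p hp).1, mem_singleton_self _⟩,
        mem_biUnion.mpr ⟨_, (hUT q hq).2, mem_singleton_self _⟩⟩
    have e4 := e3 _ hj
    have e5 : m (p.1, q.2) (∑ r ∈ U, w r • r) = ∑ r ∈ U, w r * m (p.1, q.2) r := by
      simp only [h, mul_sub, mul_add, sum_sub_distrib, sum_add_distrib] at e4
      rw [e1, e2, mul_sum, mul_sum] at e4
      have c1 : ∑ r ∈ U, w r * (K p.1 * f r.1) = ∑ r ∈ U, K p.1 * (w r * f r.1) :=
        sum_congr rfl fun r _ => by ring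
      have c2 : ∑ r ∈ U, w r * (K' q.2 * f' r.2) = ∑ r ∈ U, K' q.2 * (w r * f' r.2) :=
        sum_congr rfl fun r _ => by ring
      linarith
    have l1 : ∑ r ∈ U, w r * m (p.1, q.2) r < ∑ r ∈ U, w r * k p.1 r.1 := by
      refine sum_lt_sum (fun r hr => mul_le_mul_of_nonneg_left (min_le_left _ _) (hw r hr).le)
        ⟨p, hp, mul_lt_mul_of_pos_left ?_ (hw p hp)⟩
      rw [hm p (hUT p hp).1 (hUT p hp).2, hkv _ _ (hUT p hp).1]
      simp [hqp.not_ge]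
    have l2 : ∑ r ∈ U, w r * m (p.1, q.2) r < ∑ r ∈ U, w r * k' q.2 r.2 := by
      refine sum_lt_sum (fun r hr => mul_le_mul_of_nonneg_left (min_le_right _ _) (hw r hr).le)
        ⟨q, hq, mul_lt_mul_of_pos_left ?_ (hw q hq)⟩
      rw [hm q (hUT q hq).1 (hUT q hq).2, hkv' _ _ (hUT q hq).2]
      simp [hpq.not_ge]
    rw [← e5, ← s1] at l1
    rw [← e5, ← s2] at l2
    exact (lt_min l1 l2).ne rfl

end Assembly

/-- **Products of polytopes with regular unimodular triangulations.** If the lattice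
polytopes `P` and `P'` admit regular unimodular triangulations `T` and `T'`, then `P × P'`
admits a regular unimodular triangulation `T''` whose minimal non-faces are lifts of
minimal non-faces of `T` and of `T'` together with non-faces of cardinality two.  In
particular, if `T` and `T'` are flag (quadratic), then `T''` can be taken flag
(quadratic). -/
theorem product_regular_unimodular_triangulation {d e : ℕ}
    (P : Set (Fin d → ℝ)) (P' : Set (Fin e → ℝ))
    (hP : IsLatticePolytope Zd P) (hP' : IsLatticePolytope Zd P')
    (T : Finset (Finset (Fin d → ℝ))) (T' : Finset (Finset (Fin e → ℝ)))
    (hT : IsTriangulation P T) (hTreg : IsRegularTri P T) (hTuni : IsUnimodular Zd T)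
    (hT' : IsTriangulation P' T') (hT'reg : IsRegularTri P' T')
    (hT'uni : IsUnimodular Zd T') :
    ∃ T'' : Finset (Finset ((Fin d → ℝ) × (Fin e → ℝ))),
      IsTriangulation (P ×ˢ P') T'' ∧
      IsRegularTri (P ×ˢ P') T'' ∧
      IsUnimodular (fun x => Zd x.1 ∧ Zd x.2) T'' ∧
      (∀ N, MinNonFace T'' N →
        (N.card = 2 ∨
          (∃ M, MinNonFace T M ∧ N.image Prod.fst = M ∧ N.card = M.card) ∨
          (∃ M, MinNonFace T' M ∧ N.image Prod.snd = M ∧ N.card = M.card))) ∧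
      (IsFlag T → IsFlag T' → IsFlag T'') := by
  classical
  have hφ : Function.Injective (toLex : (Fin d → ℝ) → Lex (Fin d → ℝ)) := toLex.injective
  have hψ : Function.Injective (toLex : (Fin e → ℝ) → Lex (Fin e → ℝ)) := toLex.injective
  have hN : ∀ N, MinNonFace (stairProduct toLex toLex T T') N → #N = 2 ∨
      (∃ M, MinNonFace T M ∧ N.image Prod.fst = M ∧ #N = #M) ∨
      ∃ M, MinNonFace T' M ∧ N.image Prod.snd = M ∧ #N = #M :=
    fun N hN => stairProduct_minNonFace hN
  refine ⟨stairProduct toLex toLex T T', stairProduct_isTriangulation hφ hψ hT hT',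
    stairProduct_isRegularTri hφ hψ hT hT' hTreg hT'reg,
    stairProduct_isUnimodular hφ hψ hT hT' hTuni hT'uni, fun N h => ?_, fun hF hF' N h => ?_⟩
  · convert hN N h
  · rcases hN N h with h | ⟨M, hM, -, h⟩ | ⟨M, hM, -, h⟩
    exacts [h, h.trans (hF M hM), h.trans (hF' M hM)]
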